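/- Let G be a multigraph with |V(G)| odd, |V(G)| ≥ 3, and 2|E(G)| = k(|V(G)|−1). If χ'(G) = k and Δ(G) ≤ k−1, then χ''(G) = k. -/

import Mathlib

/-- A multigraph: a finite graph possibly with parallel edges but no loops.
Edges are abstract objects, each mapped to an unordered pair of distinct vertices. -/
structure Multigraph where
  V : Type
  E : Type
  fintypeV : Fintype V
  fintypeE : Fintype E
  decEqV : DecidableEq V
  decEqE : DecidableEq E
  ends : E → Sym2 V
  loopless : ∀ e, ¬ (ends e).IsDiag

attribute [instance] Multigraph.fintypeV Multigraph.fintypeE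
attribute [instance] Multigraph.decEqV Multigraph.decEqE

namespace Multigraph

variable (G : Multigraph)

/-- The degree of a vertex: the number of edges incident with it. -/
def degree (v : G.V) : ℕ :=
  (Finset.univ.filter fun e : G.E => v ∈ G.ends e).card

/-- The maximum degree Δ(G). -/
def maxDegree : ℕ :=
  Finset.univ.sup G.degree

/-- A proper edge coloring with color set `Fin k`: edges sharing an endpoint
receive distinct colors. -/
def IsProperEdgeColoring {k : ℕ} (φ : G.E → Fin k) : Prop :=
  ∀ e f : G.E, e ≠ f → (∃ v, v ∈ G.ends e ∧ v ∈ G.ends f) → φ e ≠ φ f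

/-- The chromatic index χ'(G): the least `k` admitting a proper edge `k`-coloring. -/
noncomputable def chromaticIndex : ℕ :=
  sInf {k | ∃ φ : G.E → Fin k, G.IsProperEdgeColoring φ}

/-- Two vertices are adjacent if some edge joins them. -/
def Adj (u v : G.V) : Prop := ∃ e, G.ends e = s(u, v)

/-- A proper total coloring with color set `Fin k`: no two adjacent or incident
elements of `V(G) ∪ E(G)` receive the same color. -/
def IsProperTotalColoring {k : ℕ} (cV : G.V → Fin k) (cE : G.E → Fin k) : Prop :=
  G.IsProperEdgeColoring cE ∧
  (∀ u v : G.V, G.Adj u v → cV u ≠ cV v) ∧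
  (∀ v e, v ∈ G.ends e → cV v ≠ cE e)

/-- The total chromatic number χ''(G): the least `k` admitting a proper total
`k`-coloring. -/
noncomputable def totalChromaticNumber : ℕ :=
  sInf {k | ∃ (cV : G.V → Fin k) (cE : G.E → Fin k), G.IsProperTotalColoring cV cE}

/-- `H` is a subgraph of `G`: there are injections of the vertices and edges of `H`
into those of `G` preserving the incidence structure. -/
def IsSubgraph (H G : Multigraph) : Prop :=
  ∃ (f : H.V → G.V) (g : H.E → G.E),
    Function.Injective f ∧ Function.Injective g ∧
    ∀ e, G.ends (g e) = (H.ends e).map f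

/-- `H` is a spanning subgraph of `G`: a subgraph whose vertex set is all of `V(G)`. -/
def IsSpanningSubgraph (H G : Multigraph) : Prop :=
  ∃ (f : H.V → G.V) (g : H.E → G.E),
    Function.Bijective f ∧ Function.Injective g ∧
    ∀ e, G.ends (g e) = (H.ends e).map f

/-- `H` is a proper subgraph of `G`. -/
def IsProperSubgraph (H G : Multigraph) : Prop :=
  IsSubgraph H G ∧ ¬ IsSubgraph G H

/-- `G` is edge-chromatic critical: every proper subgraph has a smaller chromatic index. -/
def EdgeChromaticCritical (G : Multigraph) : Prop :=
  ∀ H : Multigraph, IsProperSubgraph H G → H.chromaticIndex < G.chromaticIndex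

/-- The density ρ(G) = max{2|E(H)|/(|V(H)|−1) : H ⊆ G, |V(H)| ≥ 3 odd}
(0 if no such subgraph exists). -/
noncomputable def density (G : Multigraph) : ℝ :=
  sSup ({0} ∪ {q : ℝ | ∃ H : Multigraph, IsSubgraph H G ∧ Odd (Fintype.card H.V) ∧
    3 ≤ Fintype.card H.V ∧
    q = 2 * (Fintype.card H.E : ℝ) / ((Fintype.card H.V : ℝ) - 1)})

/-- A subgraph of `G` given by a set of vertices and a set of edges of `G`
whose endpoints all lie in the chosen vertex set. -/
structure Sub (G : Multigraph) where
  verts : Finset G.V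
  edges : Finset G.E
  support : ∀ e ∈ edges, ∀ v, v ∈ G.ends e → v ∈ verts

/-- A subgraph is `k`-dense if its order is odd and at least 3, and
`2|E(H)| = k(|V(H)|−1)`. -/
def Sub.IsDense {G : Multigraph} (S : G.Sub) (k : ℕ) : Prop :=
  Odd S.verts.card ∧ 3 ≤ S.verts.card ∧ 2 * S.edges.card = k * (S.verts.card - 1)

/-- A subgraph is maximal `k`-dense if it is `k`-dense and no `k`-dense subgraph
contains it as a proper subgraph. -/
def Sub.MaximalDense {G : Multigraph} (S : G.Sub) (k : ℕ) : Prop :=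
  S.IsDense k ∧ ∀ T : G.Sub, T.IsDense k → S.verts ⊆ T.verts → S.edges ⊆ T.edges →
    S.verts = T.verts ∧ S.edges = T.edges

/-- The set of colors of `Fin k` missing at `v` under the edge coloring `φ`. -/
def missing {k : ℕ} (φ : G.E → Fin k) (v : G.V) : Set (Fin k) :=
  {c | ∀ e : G.E, v ∈ G.ends e → φ e ≠ c}

/-- A vertex set `W` is elementary under `φ` if the sets of missing colors of
distinct vertices of `W` are disjoint. -/
def Elementary {k : ℕ} (φ : G.E → Fin k) (W : Set G.V) : Prop :=
  ∀ u ∈ W, ∀ v ∈ W, u ≠ v → Disjoint (G.missing φ u) (G.missing φ v)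

/-- An edge is a boundary edge of `W` if exactly one of its ends lies in `W`. -/
def IsBoundaryEdge (W : Set G.V) (e : G.E) : Prop :=
  ∃ a b, G.ends e = s(a, b) ∧ a ∈ W ∧ b ∉ W

/-- Deleting an edge from a multigraph. -/
def deleteEdge (G : Multigraph) (e : G.E) : Multigraph where
  V := G.V
  E := {f : G.E // f ≠ e}
  fintypeV := G.fintypeV
  fintypeE := by classical exact inferInstance
  decEqV := G.decEqV
  decEqE := by classical exact inferInstance
  ends := fun f => G.ends f.1
  loopless := fun f => G.loopless f.1

/-- Adding a new edge joining two distinct vertices of a multigraph. -/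
def addEdge (G : Multigraph) (u v : G.V) (huv : u ≠ v) : Multigraph where
  V := G.V
  E := Option G.E
  fintypeV := G.fintypeV
  fintypeE := inferInstance
  decEqV := G.decEqV
  decEqE := inferInstance
  ends := fun e => e.elim s(u, v) G.ends
  loopless := fun e => by
    cases e with
    | none => simpa using huv
    | some f => exact G.loopless f

end Multigraph

open Multigraph

namespace Multigraph

variable {G : Multigraph} {k : ℕ}

/-- The vertices incident with an edge of color `c`. -/
def covered (φ : G.E → Fin k) (c : Fin k) : Finset G.V :=
  (Finset.univ.filter fun e => φ e = c).biUnion fun e => (G.ends e).toFinset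

theorem mem_covered {φ : G.E → Fin k} {c : Fin k} {v : G.V} :
    v ∈ G.covered φ c ↔ ∃ e, φ e = c ∧ v ∈ G.ends e := by
  simp [covered]

theorem notMem_covered_iff_mem_missing {φ : G.E → Fin k} {c : Fin k} {v : G.V} :
    v ∉ G.covered φ c ↔ c ∈ G.missing φ v := by
  rw [mem_covered, missing, Set.mem_ofPred_eq]
  exact ⟨fun h e hv hc => h ⟨e, hc, hv⟩, fun h ⟨e, hc, hv⟩ => h e hv hc⟩

/-- Each edge of a color class of a proper edge coloring covers two vertices of its own. -/
theorem IsProperEdgeColoring.card_covered {φ : G.E → Fin k}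
    (hφ : G.IsProperEdgeColoring φ) (c : Fin k) :
    (G.covered φ c).card = 2 * (Finset.univ.filter fun e => φ e = c).card := by
  rw [covered, Finset.card_biUnion]
  · rw [Finset.sum_congr rfl fun e _ => Sym2.card_toFinset_of_not_isDiag _ (G.loopless e)]
    simp [mul_comm]
  · intro e he f hf hef
    replace he := (Finset.mem_filter.1 he).2
    replace hf := (Finset.mem_filter.1 hf).2
    refine Finset.disjoint_left.2 ?_
    intro v hve hvf
    rw [Sym2.mem_toFinset] at hve hvf
    exact hφ e f hef ⟨v, hve, hvf⟩ (he.trans hf.symm)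

theorem IsProperEdgeColoring.sum_card_covered {φ : G.E → Fin k}
    (hφ : G.IsProperEdgeColoring φ) :
    ∑ c, (G.covered φ c).card = 2 * Fintype.card G.E := by
  simp_rw [hφ.card_covered, ← Finset.mul_sum]
  rw [← Finset.card_univ,
    Finset.card_eq_sum_card_fiberwise (f := φ) (t := Finset.univ) (by simp)]

/-- In a `k`-dense multigraph, every color of a proper edge `k`-coloring is missing at no more
than one vertex. -/
theorem IsProperEdgeColoring.elementary_univ {φ : G.E → Fin k}
    (hφ : G.IsProperEdgeColoring φ) (hodd : Odd (Fintype.card G.V))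
    (hdense : 2 * Fintype.card G.E = k * (Fintype.card G.V - 1)) :
    G.Elementary φ Set.univ := by
  intro u _ v _ huv
  rw [Set.disjoint_left]
  intro c hu hv
  have hle : ∀ d, (G.covered φ d).card ≤ Fintype.card G.V - 1 := by
    intro d
    have h := Finset.card_le_univ (G.covered φ d)
    rw [hφ.card_covered] at h ⊢
    obtain ⟨m, hm⟩ := hodd
    omega
  have hlt : (G.covered φ c).card < Fintype.card G.V - 1 := by
    have hsub : G.covered φ c ⊆ Finset.univ \ {u, v} := by
      intro w hw
      simp only [Finset.mem_sdiff, Finset.mem_univ, true_and, Finset.mem_insert,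
        Finset.mem_singleton, not_or]
      constructor
      · rintro rfl
        exact notMem_covered_iff_mem_missing.2 hu hw
      · rintro rfl
        exact notMem_covered_iff_mem_missing.2 hv hw
    have h := Finset.card_le_card hsub
    have hpair : ({u, v} : Finset G.V).card ≤ Fintype.card G.V := Finset.card_le_univ _
    rw [Finset.card_sdiff_of_subset (Finset.subset_univ _), Finset.card_univ] at h
    rw [Finset.card_pair huv] at h hpair
    obtain ⟨m, hm⟩ := hodd
    omega
  have hsum := Finset.sum_lt_sum (fun d _ => hle d) ⟨c, Finset.mem_univ c, hlt⟩
  rw [hφ.sum_card_covered, hdense] at hsum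
  simp at hsum

/-- A vertex whose degree is less than the number of colors misses a color. -/
theorem missing_nonempty_of_degree_lt (φ : G.E → Fin k) {v : G.V} (hv : G.degree v < k) :
    (G.missing φ v).Nonempty := by
  have h : ((Finset.univ.filter fun e => v ∈ G.ends e).image φ).card
      < (Finset.univ : Finset (Fin k)).card := by
    rw [Finset.card_univ, Fintype.card_fin]
    exact Finset.card_image_le.trans_lt hv
  obtain ⟨c, -, hc⟩ := Finset.exists_mem_notMem_of_card_lt_card h
  refine ⟨c, fun e he hec => hc ?_⟩
  exact Finset.mem_image.2 ⟨e, by simpa using he, hec⟩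

theorem degree_le_maxDegree (v : G.V) : G.degree v ≤ G.maxDegree :=
  Finset.le_sup (Finset.mem_univ v)

/-- If the missing color sets are pairwise disjoint and nonempty, then coloring each vertex with
one of its missing colors extends the edge coloring to a total coloring. -/
theorem IsProperEdgeColoring.exists_total {φ : G.E → Fin k}
    (hφ : G.IsProperEdgeColoring φ) (hel : G.Elementary φ Set.univ)
    (hne : ∀ v, (G.missing φ v).Nonempty) :
    ∃ cV : G.V → Fin k, G.IsProperTotalColoring cV φ := by
  choose cV hcV using hne
  refine ⟨cV, hφ, ?_, fun v e hv h => hcV v e hv h.symm⟩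
  rintro u v ⟨e, he⟩ h
  have huv : u ≠ v := by
    rintro rfl
    exact G.loopless e (by simp [he])
  exact Set.disjoint_left.1 (hel u trivial v trivial huv) (hcV u) (h ▸ hcV v)

end Multigraph

/-- If `G` is a `k`-dense multigraph (|V(G)| odd, |V(G)| ≥ 3 and
2|E(G)| = k(|V(G)|−1)) with χ'(G) = k and Δ(G) ≤ k−1, then χ''(G) = k. -/
theorem total_eq_of_dense
    (G : Multigraph) (k : ℕ)
    (hodd : Odd (Fintype.card G.V)) (h3 : 3 ≤ Fintype.card G.V)
    (hdense : 2 * Fintype.card G.E = k * (Fintype.card G.V - 1))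
    (hchi : G.chromaticIndex = k)
    (hΔ : (G.maxDegree : ℤ) ≤ (k : ℤ) - 1) :
    G.totalChromaticNumber = k := by
  have hk : 0 < k := by omega
  have hmem : G.chromaticIndex ∈ {k | ∃ φ : G.E → Fin k, G.IsProperEdgeColoring φ} :=
    Nat.sInf_mem (Nat.nonempty_of_pos_sInf (hchi.symm ▸ hk : 0 < G.chromaticIndex))
  rw [hchi] at hmem
  obtain ⟨φ, hφ⟩ := hmem
  obtain ⟨cV, hcV⟩ := hφ.exists_total (hφ.elementary_univ hodd hdense) fun v =>
    missing_nonempty_of_degree_lt φ (by have := G.degree_le_maxDegree v; omega)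
  apply le_antisymm
  · exact Nat.sInf_le ⟨cV, φ, hcV⟩
  · refine le_csInf ⟨k, cV, φ, hcV⟩ ?_
    rintro m ⟨_, cE, hcE⟩
    rw [← hchi]
    exact Nat.sInf_le ⟨cE, hcE.1⟩
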